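/- arXiv:1907.03345 — 5 statements merged into one kernel-verified Lean document; each statement's English description precedes it below -/
import Mathlib

section
/- There exist a positive integer k with n = k(p-1), nonzero ideals I_1, ..., I_k of the ring of integers ℤ[ζ] of the p-th cyclotomic field (where ζ = e^{2πi/p}), and an isomorphism of abelian groups ℤ^n ≅ I_1 ⊕ ... ⊕ I_k which is equivariant for the ℤ/p-actions, where the generator s of ℤ/p acts on ℤ^n by ρ(s) and on each ideal I_j by multiplication by ζ. -/
set_option synthInstance.maxHeartbeats 1000000
set_option maxHeartbeats 1000000

open Complex

/-- `ζ = e^{2πi/p}`, a primitive `p`-th root of unity in `ℂ`. -/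
noncomputable def zetaC (p : ℕ) : ℂ := Complex.exp (2 * Real.pi * Complex.I / p)

/-- `ℤ[ζ]`, the ring of integers of the `p`-th cyclotomic field, realized as the subring of `ℂ`
generated over `ℤ` by `ζ = e^{2πi/p}`. -/
noncomputable def Zzeta (p : ℕ) : Subalgebra ℤ ℂ := Algebra.adjoin ℤ {zetaC p}

/-- `ζ` as an element of `ℤ[ζ]`. -/
noncomputable def zetaZ (p : ℕ) : Zzeta p :=
  ⟨zetaC p, Algebra.self_mem_adjoin_singleton ℤ (zetaC p)⟩

theorem IsDedekindDomain.of_ringEquiv {R S : Type*} [CommRing R] [CommRing S] [IsDedekindDomain S]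
    (e : R ≃+* S) : IsDedekindDomain R :=
  have : IsDomain R := e.toMulEquiv.isDomain S
  have : IsNoetherianRing R := isNoetherianRing_of_ringEquiv S e.symm
  have : Ring.DimensionLEOne R := .of_ringEquiv e
  have : IsIntegrallyClosed R := .of_equiv e.symm
  { }

theorem Module.Projective.of_isDedekindDomain (R M : Type*) [CommRing R] [IsDedekindDomain R]
    [AddCommGroup M] [Module R M] [Module.Finite R M] [Module.IsTorsionFree R M] :
    Module.Projective R M :=
  have : Module.FinitePresentation R M := Module.finitePresentation_of_finite R M
  Module.Flat.projective_of_finitePresentation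

/-- A finitely generated torsion-free module over a Dedekind domain is isomorphic to a finite
direct sum of nonzero ideals. -/
theorem Module.exists_linearEquiv_pi_ideal (R : Type*) [CommRing R] [IsDedekindDomain R]
    (M : Type*) [AddCommGroup M] [Module R M] [Module.Finite R M] [Module.IsTorsionFree R M] :
    ∃ (k : ℕ) (I : Fin k → Ideal R), (∀ j, I j ≠ ⊥) ∧
      Nonempty (M ≃ₗ[R] ((j : Fin k) → I j)) := by
  induction hd : Module.finrank R M using Nat.strong_induction_on generalizing M with
  | _ d ih =>
  rcases subsingleton_or_nontrivial M with hM | hM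
  · exact ⟨0, Fin.elim0, fun j ↦ j.elim0, ⟨0, 0, fun _ ↦ Subsingleton.elim _ _,
      fun _ ↦ Subsingleton.elim _ _⟩⟩
  obtain ⟨x, hx⟩ := exists_ne (0 : M)
  have := Module.Projective.of_isDedekindDomain R M
  obtain ⟨f, hf⟩ : ∃ f : Module.Dual R M, f x ≠ 0 := by
    by_contra! h
    exact hx ((Module.forall_dual_apply_eq_zero_iff R x).1 h)
  have hI : LinearMap.range f ≠ ⊥ := by
    rw [Ne, LinearMap.range_eq_bot]
    rintro rfl
    exact hf rfl
  have : Module.Projective R (LinearMap.range f) := .of_isDedekindDomain _ _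
  have hrank : Module.finrank R (LinearMap.ker f) < d := by
    have h1 := Submodule.finrank_quotient_add_finrank (LinearMap.ker f)
    rw [f.quotKerEquivRange.finrank_eq] at h1
    have : Nontrivial (LinearMap.range f) := Submodule.nontrivial_iff_ne_bot.2 hI
    have := Module.finrank_pos (R := R) (M := LinearMap.range f)
    lia
  obtain ⟨k, I, hIk, ⟨e⟩⟩ := ih _ hrank (LinearMap.ker f) rfl
  obtain ⟨l, hl⟩ := f.rangeRestrict.exists_rightInverse_of_surjective f.range_rangeRestrict
  have hex : Function.Exact (LinearMap.ker f).subtype f.rangeRestrict := by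
    rw [LinearMap.exact_iff]
    simp
  let e₁ := (hex.splitSurjectiveEquiv (Submodule.subtype_injective _) ⟨l, hl⟩).1
  let e₂ := (e₁.trans (LinearEquiv.prodComm R _ _)).trans
    ((LinearEquiv.refl R (LinearMap.range f)).prodCongr e)
  exact ⟨k + 1, Fin.cons (LinearMap.range f) I, Fin.cases hI hIk,
    ⟨e₂.trans (Fin.consLinearEquiv R fun j ↦
      ((Fin.cons (LinearMap.range f) I : Fin (k + 1) → Ideal R) j))⟩⟩

theorem Module.IsTorsionFree.of_isIntegral (R S M : Type*) [CommRing R] [CommRing S] [IsDomain S]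
    [IsDomain R] [Algebra R S] [Algebra.IsIntegral R S]
    [AddCommGroup M] [Module R M] [Module S M] [IsScalarTower R S M] [Module.IsTorsionFree R M] :
    Module.IsTorsionFree S M := by
  refine .of_smul_eq_zero fun s m h ↦ ?_
  by_contra! hne
  obtain ⟨r, hr, t, ht⟩ := (Algebra.IsAlgebraic.isAlgebraic (R := R) s).exists_nonzero_dvd
    (mem_nonZeroDivisors_of_ne_zero hne.1)
  have : r • m = 0 := by
    rw [← algebraMap_smul S r m, ht, mul_comm, mul_smul, h, smul_zero]
  exact (smul_eq_zero.1 this).elim hr hne.2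

theorem isPrimitiveRoot_zetaC {p : ℕ} (hp : p ≠ 0) : IsPrimitiveRoot (zetaC p) p :=
  Complex.isPrimitiveRoot_exp p hp

/-- The power basis of `ℤ[ζ]` over `ℤ` generated by `ζ`. -/
noncomputable def Zzeta.powerBasis {p : ℕ} (hp : 0 < p) : PowerBasis ℤ (Zzeta p) :=
  Algebra.adjoin.powerBasis' ((isPrimitiveRoot_zetaC hp.ne').isIntegral hp)

theorem Zzeta.powerBasis_gen {p : ℕ} (hp : 0 < p) : (powerBasis hp).gen = zetaZ p :=
  Algebra.adjoin.powerBasis'_gen _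

theorem Zzeta.minpoly_zetaZ {p : ℕ} (hp : 0 < p) :
    minpoly ℤ (zetaZ p) = Polynomial.cyclotomic p ℤ := by
  rw [Polynomial.cyclotomic_eq_minpoly (isPrimitiveRoot_zetaC hp.ne') hp]
  exact (minpoly.algebraMap_eq (B' := ℂ) Subtype.val_injective (zetaZ p)).symm

theorem Zzeta.powerBasis_dim {p : ℕ} (hp : p.Prime) : (powerBasis hp.pos).dim = p - 1 := by
  rw [← PowerBasis.natDegree_minpoly, powerBasis_gen, minpoly_zetaZ hp.pos,
    Polynomial.natDegree_cyclotomic, Nat.totient_prime hp]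

theorem Zzeta.isDedekindDomain {p : ℕ} (hp : 0 < p) : IsDedekindDomain (Zzeta p) := by
  have : NeZero p := ⟨hp.ne'⟩
  have : IsCyclotomicExtension {p} ℚ (CyclotomicField p ℚ) :=
    CyclotomicField.isCyclotomicExtension p ℚ
  have hζ := IsCyclotomicExtension.zeta_spec p ℚ (CyclotomicField p ℚ)
  refine .of_ringEquiv ((powerBasis hp).equivOfMinpoly hζ.integralPowerBasis ?_).toRingEquiv
  rw [powerBasis_gen, minpoly_zetaZ hp, hζ.integralPowerBasis_gen,
    Polynomial.cyclotomic_eq_minpoly hζ hp]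
  exact minpoly.algebraMap_eq NumberField.RingOfIntegers.coe_injective hζ.toInteger

theorem Ideal.finrank_eq_of_ne_bot {R S : Type*} [CommRing R] [IsDomain R] [IsPrincipalIdealRing R]
    [CommRing S] [IsDomain S] [Algebra R S] [Module.Free R S] [Module.Finite R S]
    {I : Ideal S} (hI : I ≠ ⊥) : Module.finrank R I = Module.finrank R S := by
  have b := Module.Free.chooseBasis R S
  have c := I.selfBasis b hI
  rw [Module.finrank_eq_card_basis b, Module.finrank_eq_card_basis c]

open Polynomial in
/-- An endomorphism of a free abelian group of finite rank that is killed by the `p`-th cyclotomic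
polynomial is conjugate to multiplication by `ζ` on a direct sum of ideals of `ℤ[ζ]`. -/
theorem Zzeta.exists_addEquiv_pi_ideal {p : ℕ} (hp : p.Prime) {V : Type*} [AddCommGroup V]
    [Module.Finite ℤ V] [Module.Free ℤ V] (T : Module.End ℤ V)
    (hT : aeval T (cyclotomic p ℤ) = 0) :
    ∃ (k : ℕ) (I : Fin k → Ideal (Zzeta p)), Module.finrank ℤ V = k * (p - 1) ∧
      (∀ j, I j ≠ ⊥) ∧ ∃ e : V ≃+ ((j : Fin k) → I j),
        ∀ v j, (e (T v) j : Zzeta p) = zetaZ p * (e v j : Zzeta p) := by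
  have hgen : aeval T (minpoly ℤ (powerBasis hp.pos).gen) = 0 := by
    rwa [powerBasis_gen, minpoly_zetaZ hp.pos]
  let φ := (powerBasis hp.pos).lift T hgen
  have hφ : φ (zetaZ p) = T := by
    rw [← powerBasis_gen hp.pos]
    exact (powerBasis hp.pos).lift_gen T hgen
  let _ : Module (Zzeta p) V := Module.compHom V φ.toRingHom
  have hsmul (v : V) : zetaZ p • v = T v := LinearMap.congr_fun hφ v
  have : Module.Finite ℤ (Zzeta p) := (powerBasis hp.pos).finite
  have : Module.Free ℤ (Zzeta p) := .of_basis (powerBasis hp.pos).basis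
  have := isDedekindDomain hp.pos
  have : Module.IsTorsionFree (Zzeta p) V := .of_isIntegral ℤ _ _
  have : Module.Finite (Zzeta p) V := .of_restrictScalars_finite ℤ _ _
  obtain ⟨k, I, hI, ⟨e⟩⟩ := Module.exists_linearEquiv_pi_ideal (Zzeta p) V
  refine ⟨k, I, ?_, hI, e.toAddEquiv, fun v j ↦ ?_⟩
  · rw [(e.toAddEquiv.toIntLinearEquiv).finrank_eq, Module.finrank_pi_fintype]
    simp [Ideal.finrank_eq_of_ne_bot (hI _), (powerBasis hp.pos).finrank, powerBasis_dim hp]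
  · rw [← hsmul]
    simp

/-- There are a positive integer `k` with `n = k(p-1)`, nonzero ideals `I₁, …, I_k` of `ℤ[ζ]`,
and an isomorphism of abelian groups `ℤⁿ ≅ I₁ ⊕ ⋯ ⊕ I_k` which is equivariant for the
`ℤ/p`-actions, where the generator `s` acts on `ℤⁿ` by `ρ(s)` and on each ideal by
multiplication by `ζ`. -/
theorem zn_iso_direct_sum_of_ideals (p n : ℕ) (hp : p.Prime) (hodd : Odd p) (hn : 0 < n)
    (ρ : Multiplicative (ZMod p) →* Matrix.GeneralLinearGroup (Fin n) ℤ)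
    (hfree : ∀ g : Multiplicative (ZMod p), g ≠ 1 → ∀ v : Fin n → ℤ,
      (ρ g : Matrix (Fin n) (Fin n) ℤ).mulVec v = v → v = 0)
    (s : ZMod p) (hs : addOrderOf s = p) :
    ∃ k : ℕ, 0 < k ∧ n = k * (p - 1) ∧
      ∃ I : Fin k → Ideal (Zzeta p), (∀ j, I j ≠ ⊥) ∧
        ∃ e : (Fin n → ℤ) ≃+ ((j : Fin k) → I j),
          ∀ (v : Fin n → ℤ) (j : Fin k),
            (e ((ρ (Multiplicative.ofAdd s) : Matrix (Fin n) (Fin n) ℤ).mulVec v) j :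
                Zzeta p) =
              zetaZ p * (e v j : Zzeta p) := by
  have : Fact p.Prime := ⟨hp⟩
  set A : Matrix (Fin n) (Fin n) ℤ :=
    (ρ (Multiplicative.ofAdd s)).val with hA
  have hs1 : Multiplicative.ofAdd s ≠ 1 := by
    rintro h
    rw [ofAdd_eq_one] at h
    exact hp.one_lt.ne' (by rw [← hs, h, addOrderOf_zero])
  have hAp : A ^ p = 1 := by
    have h : Multiplicative.ofAdd s ^ p = 1 := by
      rw [← ofAdd_nsmul, addOrderOf_dvd_iff_nsmul_eq_zero.1 hs.dvd, ofAdd_zero]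
    rw [hA, ← Units.val_pow_eq_pow_val, ← map_pow, h, map_one, Units.val_one]
  have hT : Polynomial.aeval (Matrix.toLin' A) (Polynomial.cyclotomic p ℤ) = 0 := by
    have h : (A - 1) * Polynomial.aeval A (Polynomial.cyclotomic p ℤ) = 0 := by
      rw [Polynomial.cyclotomic_prime]
      simp [mul_geom_sum, hAp]
    have h0 : Polynomial.aeval A (Polynomial.cyclotomic p ℤ) = 0 := by
      refine Matrix.ext_of_mulVec_single fun i ↦ ?_
      rw [Matrix.zero_mulVec]
      refine hfree _ hs1 _ ?_
      rw [← sub_eq_zero, ← hA, Matrix.mulVec_mulVec, ← Matrix.sub_mulVec, ← sub_one_mul, h,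
        Matrix.zero_mulVec]
    have := Polynomial.aeval_algHom_apply (Matrix.toLinAlgEquiv' (R := ℤ) (n := Fin n)) A
      (Polynomial.cyclotomic p ℤ)
    rw [h0, map_zero] at this
    exact this
  obtain ⟨k, I, hk, hI, e, he⟩ := Zzeta.exists_addEquiv_pi_ideal hp (Matrix.toLin' A) hT
  rw [Module.finrank_fin_fun] at hk
  exact ⟨k, Nat.pos_of_ne_zero (by rintro rfl; simp at hk; lia), hk, I, hI, e, he⟩
end

section
/- The set 𝒫 of conjugacy classes of nontrivial finite subgroups of Γ is finite and has exactly p^k elements. -/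
open Multiplicative

/-- The action of `GL n ℤ` on `ℤⁿ`, as a homomorphism
`Multiplicative (ZMod p) →* MulAut (Multiplicative (Fin n → ℤ))`. -/
def matAutHom {p n : ℕ} (ρ : Multiplicative (ZMod p) →* Matrix.GeneralLinearGroup (Fin n) ℤ) :
    Multiplicative (ZMod p) →* MulAut (Multiplicative (Fin n → ℤ)) where
  toFun g :=
    { toFun := fun v => Multiplicative.ofAdd ((ρ g : Matrix (Fin n) (Fin n) ℤ).mulVec v.toAdd)
      invFun := fun v =>
        Multiplicative.ofAdd ((((ρ g)⁻¹ : Matrix.GeneralLinearGroup (Fin n) ℤ) :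
          Matrix (Fin n) (Fin n) ℤ).mulVec v.toAdd)
      left_inv := fun v => by simp [Matrix.mulVec_mulVec]
      right_inv := fun v => by simp [Matrix.mulVec_mulVec]
      map_mul' := fun u v => by simp [Matrix.mulVec_add] }
  map_one' := by ext v; simp
  map_mul' g h := by ext v; simp [Matrix.mulVec_mulVec]

/-- The group `Γ = ℤⁿ ⋊_ρ ℤ/p`. -/
abbrev Gamma {p n : ℕ} (ρ : Multiplicative (ZMod p) →* Matrix.GeneralLinearGroup (Fin n) ℤ) :
    Type :=
  SemidirectProduct (Multiplicative (Fin n → ℤ)) (Multiplicative (ZMod p)) (matAutHom ρ)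

/-- The conjugacy relation on the set of nontrivial finite subgroups of a group. -/
def ConjRel {G : Type*} [Group G] (P Q : {P : Subgroup G // P ≠ ⊥ ∧ Finite P}) : Prop :=
  ∃ γ : G, Subgroup.map (MulAut.conj γ).toMonoidHom P.1 = Q.1

open Polynomial in
theorem cyclotomic_dvd_prod_one_sub_X_pow_sub {p : ℕ} (hp : p.Prime) :
    cyclotomic p ℤ ∣ ∏ j ∈ Finset.range (p - 1), (1 - X ^ (j + 1)) - (p : ℤ[X]) := by
  have hζ := Complex.isPrimitiveRoot_exp p hp.ne_zero
  have hζ' : IsPrimitiveRoot (Complex.exp (2 * Real.pi * Complex.I / p)) (p - 1 + 1) := by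
    rwa [Nat.sub_add_cancel hp.one_le]
  rw [cyclotomic_eq_minpoly hζ hp.pos]
  apply minpoly.isIntegrallyClosed_dvd (hζ.isIntegral hp.pos)
  have h := hζ'.prod_one_sub_pow_eq_order
  rw [← Nat.cast_add_one, Nat.sub_add_cancel hp.one_le] at h
  simp [map_prod, h]

namespace Matrix

variable {m : Type*} [Fintype m] [DecidableEq m]

theorem natAbs_det_one_sub_pow_of_geom_sum_eq_zero {p : ℕ} (hp : p.Prime) (A : Matrix m m ℤ)
    (hA : ∑ i ∈ Finset.range p, A ^ i = 0) :
    (1 - A).det.natAbs ^ (p - 1) = p ^ Fintype.card m := by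
  have := Fact.mk hp
  have hprod : ((List.range (p - 1)).map fun j => 1 - A ^ (j + 1)).prod = (p : Matrix m m ℤ) := by
    obtain ⟨q, hq⟩ := cyclotomic_dvd_prod_one_sub_X_pow_sub hp
    have h := congrArg (Polynomial.aeval A) hq
    rw [Polynomial.cyclotomic_prime] at h
    simp only [map_sub, map_mul, map_sum, map_pow, Polynomial.aeval_X, hA, zero_mul,
      map_natCast, sub_eq_zero] at h
    rw [← h, Finset.prod_eq_multiset_prod, Finset.range_val, Multiset.range, Multiset.map_coe,
      Multiset.prod_coe, map_list_prod, List.map_map]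
    simp [Function.comp_def]
  have hpow : A ^ p = 1 := by
    rw [← sub_eq_zero, ← mul_geom_sum, hA, mul_zero]
  have hdet : ∀ j ∈ List.range (p - 1), (1 - A ^ (j + 1)).det.natAbs = (1 - A).det.natAbs := by
    intro j hj
    rw [List.mem_range] at hj
    have hcop : (j + 1).Coprime p :=
      (Nat.coprime_of_lt_prime (by omega) (by omega) hp).symm
    obtain ⟨l, -, hl⟩ := Nat.exists_mul_mod_eq_one_of_coprime hcop hp.one_lt
    have hAl : (A ^ (j + 1)) ^ l = A := by
      rw [← pow_mul, ← Nat.div_add_mod ((j + 1) * l) p, hl, pow_add, pow_mul, hpow]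
      simp
    apply Nat.dvd_antisymm <;> rw [Int.natAbs_dvd_natAbs]
    · obtain ⟨B, hB⟩ := one_sub_dvd_one_sub_pow (A ^ (j + 1)) l
      rw [hAl] at hB
      rw [hB, det_mul]
      exact dvd_mul_right _ _
    · obtain ⟨B, hB⟩ := one_sub_dvd_one_sub_pow A (j + 1)
      rw [hB, det_mul]
      exact dvd_mul_right _ _
  have h := congrArg (Int.natAbsHom.toMonoidHom.comp detMonoidHom) hprod
  rw [map_list_prod, List.map_map,
    List.map_congr_left (f := _ ∘ _) (g := fun _ => (1 - A).det.natAbs) hdet,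
    List.map_const', List.prod_replicate, List.length_range] at h
  rw [h, ← diagonal_natCast]
  simp [Int.natAbs_pow]

theorem card_quotient_range_mulVecLin (B : Matrix m m ℤ)
    (hB : Function.Injective B.mulVecLin) :
    Nat.card ((m → ℤ) ⧸ LinearMap.range B.mulVecLin) = B.det.natAbs := by
  rw [← Submodule.natAbs_det_equiv _ (LinearEquiv.ofInjective _ hB), ← LinearMap.det_toLin']
  rfl

theorem pow_mulVec_sub_mem_range (A : Matrix m m ℤ) (j : ℕ) (u : m → ℤ) :
    (A ^ j).mulVec u - u ∈ LinearMap.range (1 - A).mulVecLin := by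
  obtain ⟨B, hB⟩ := one_sub_dvd_one_sub_pow A j
  refine ⟨-(B.mulVec u), ?_⟩
  rw [mulVecLin_apply, mulVec_neg, mulVec_mulVec, ← hB, sub_mulVec, one_mulVec, neg_sub]

end Matrix

theorem equivalence_conjRel {G : Type*} [Group G] : Equivalence (ConjRel (G := G)) where
  refl P := ⟨1, by ext; simp⟩
  symm := by
    rintro P Q ⟨γ, h⟩
    refine ⟨γ⁻¹, ?_⟩
    rw [← h, Subgroup.map_map]
    ext; simp [mul_assoc]
  trans := by
    rintro P Q R ⟨γ, h⟩ ⟨δ, h'⟩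
    refine ⟨δ * γ, ?_⟩
    rw [← h', ← h, Subgroup.map_map]
    congr 1
    ext; simp

namespace Gamma

variable {p n : ℕ} (ρ : Multiplicative (ZMod p) →* Matrix.GeneralLinearGroup (Fin n) ℤ)

/-- The matrix by which the generator of `ℤ/p` acts. -/
def genMatrix : Matrix (Fin n) (Fin n) ℤ := ρ (ofAdd 1)

/-- The element `(u, 1)` of `Γ`, with `1` the generator of `ℤ/p`. -/
def lift (u : Fin n → ℤ) : Gamma ρ := ⟨ofAdd u, ofAdd 1⟩

variable {ρ}

theorem coe_apply_eq_genMatrix_pow [NeZero p] (g : Multiplicative (ZMod p)) :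
    (ρ g : Matrix (Fin n) (Fin n) ℤ) = genMatrix ρ ^ g.toAdd.val := by
  have : g = ofAdd (1 : ZMod p) ^ g.toAdd.val := by
    rw [← ofAdd_nsmul]; simp
  conv_lhs => rw [this]
  simp [genMatrix]

theorem toAdd_mul_left (x y : Gamma ρ) :
    (x * y).left.toAdd =
      x.left.toAdd + (ρ x.right : Matrix (Fin n) (Fin n) ℤ).mulVec y.left.toAdd := rfl

theorem toAdd_lift_pow_left (u : Fin n → ℤ) (m : ℕ) :
    (lift ρ u ^ m).left.toAdd = (∑ i ∈ Finset.range m, genMatrix ρ ^ i).mulVec u := by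
  induction m with
  | zero => simp
  | succ m ih =>
    rw [pow_succ', toAdd_mul_left, ih, Finset.sum_range_succ', Matrix.add_mulVec, pow_zero,
      Matrix.one_mulVec, Matrix.mulVec_mulVec, Finset.mul_sum, add_comm]
    simp only [pow_succ']
    rfl

theorem pow_right (x : Gamma ρ) (m : ℕ) : (x ^ m).right = x.right ^ m :=
  map_pow SemidirectProduct.rightHom x m

theorem eq_one_of_isOfFinOrder {x : Gamma ρ} (hx : IsOfFinOrder x) (h : x.right = 1) : x = 1 := by
  obtain ⟨m, hm, hxm⟩ := isOfFinOrder_iff_pow_eq_one.mp hx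
  have hx' : x = SemidirectProduct.inl x.left := by ext <;> simp [h]
  rw [hx', ← map_pow, ← map_one SemidirectProduct.inl, SemidirectProduct.inl_inj,
    ← toAdd_eq_zero, toAdd_pow, smul_eq_zero_iff_right hm.ne', toAdd_eq_zero] at hxm
  rw [hx', hxm, map_one]

theorem eq_of_mem_of_right_eq {P : Subgroup (Gamma ρ)} [Finite P] {x y : Gamma ρ} (hx : x ∈ P)
    (hy : y ∈ P) (h : x.right = y.right) : x = y := by
  rw [← mul_inv_eq_one]
  have hxy : x * y⁻¹ ∈ P := P.mul_mem hx (P.inv_mem hy)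
  refine eq_one_of_isOfFinOrder ?_ (by simp [h])
  exact Submonoid.isOfFinOrder_coe.mpr (isOfFinOrder_of_finite (⟨_, hxy⟩ : P))

theorem exists_eq_zpowers_lift [Fact p.Prime] {P : Subgroup (Gamma ρ)} [Finite P] (hP : P ≠ ⊥) :
    ∃ u, P = Subgroup.zpowers (lift ρ u) := by
  obtain ⟨x, hxP, hx⟩ := P.bot_or_exists_ne_one.resolve_left hP
  have hxr : x.right.toAdd ≠ 0 := fun h =>
    hx (eq_of_mem_of_right_eq hxP P.one_mem h)
  set m := (x.right.toAdd⁻¹).val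
  have hr : (x ^ m).right = ofAdd 1 := by
    rw [pow_right, ← ofAdd_toAdd x.right, ← ofAdd_nsmul, nsmul_eq_mul, ZMod.natCast_zmod_val,
      inv_mul_cancel₀ hxr]
  have hlift : lift ρ (x ^ m).left.toAdd = x ^ m := by
    ext1
    · rfl
    · exact hr.symm
  refine ⟨(x ^ m).left.toAdd, le_antisymm (fun z hz => ?_) ?_⟩
  · rw [hlift]
    refine ⟨z.right.toAdd.val, ?_⟩
    refine eq_of_mem_of_right_eq (P.zpow_mem (P.pow_mem hxP m) _) hz ?_
    simp only [zpow_natCast]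
    rw [pow_right, hr, ← ofAdd_nsmul]
    simp
  · rw [hlift, Subgroup.zpowers_le]
    exact P.pow_mem hxP m

variable (hfree : ∀ v : Fin n → ℤ, (genMatrix ρ).mulVec v = v → v = 0)
include hfree

theorem geom_sum_genMatrix_eq_zero [NeZero p] : ∑ i ∈ Finset.range p, genMatrix ρ ^ i = 0 := by
  have hpow : genMatrix ρ ^ p = 1 := by
    have : (ofAdd (1 : ZMod p)) ^ p = 1 := by
      rw [← ofAdd_nsmul, nsmul_one, ZMod.natCast_self, ofAdd_zero]
    have h := congrArg ρ this
    rw [map_pow, map_one ρ] at h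
    exact congrArg Units.val h
  refine Matrix.ext_of_mulVec_single fun i => ?_
  rw [Matrix.zero_mulVec]
  apply hfree
  rw [Matrix.mulVec_mulVec, ← sub_eq_zero, ← Matrix.sub_mulVec]
  have h := mul_geom_sum (genMatrix ρ) p
  rw [sub_one_mul, hpow, sub_self] at h
  rw [h, Matrix.zero_mulVec]

theorem isOfFinOrder_lift [Fact p.Prime] (u : Fin n → ℤ) : IsOfFinOrder (lift ρ u) := by
  refine isOfFinOrder_iff_pow_eq_one.mpr ⟨p, (Fact.out : p.Prime).pos, ?_⟩
  ext1
  · rw [← toAdd.injective.eq_iff, toAdd_lift_pow_left, geom_sum_genMatrix_eq_zero hfree,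
      Matrix.zero_mulVec]
    rfl
  · rw [pow_right]
    change ofAdd (1 : ZMod p) ^ p = 1
    rw [← ofAdd_nsmul, nsmul_one, ZMod.natCast_self, ofAdd_zero]

/-- The finite subgroup generated by `(u, 1)`. -/
def zpowersLift [Fact p.Prime] (u : Fin n → ℤ) : {P : Subgroup (Gamma ρ) // P ≠ ⊥ ∧ Finite P} :=
  ⟨Subgroup.zpowers (lift ρ u), by
    rw [Ne, Subgroup.zpowers_eq_bot]
    intro h
    exact one_ne_zero (α := ZMod p) (congrArg (fun x : Gamma ρ => x.right.toAdd) h),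
    finite_zpowers.mpr (isOfFinOrder_lift hfree u)⟩

theorem conjRel_zpowersLift_iff [Fact p.Prime] (u v : Fin n → ℤ) :
    ConjRel (zpowersLift hfree u) (zpowersLift hfree v) ↔
      v - u ∈ LinearMap.range (1 - genMatrix ρ).mulVecLin := by
  constructor
  · rintro ⟨γ, h⟩
    have hmem : γ * lift ρ u * γ⁻¹ ∈ (zpowersLift hfree v).1 := by
      rw [← h]
      exact ⟨lift ρ u, Subgroup.mem_zpowers _, rfl⟩
    have := (zpowersLift hfree v).2.2
    have heq : γ * lift ρ u * γ⁻¹ = lift ρ v :=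
      eq_of_mem_of_right_eq hmem (Subgroup.mem_zpowers _) (by
        simp only [SemidirectProduct.mul_right, SemidirectProduct.inv_right]
        exact mul_inv_cancel_comm _ _)
    rw [mul_inv_eq_iff_eq_mul] at heq
    have hl : γ.left.toAdd + (ρ γ.right : Matrix (Fin n) (Fin n) ℤ).mulVec u =
        v + (genMatrix ρ).mulVec γ.left.toAdd :=
      congrArg (fun x : Gamma ρ => x.left.toAdd) heq
    rw [coe_apply_eq_genMatrix_pow] at hl
    have : v - u = (1 - genMatrix ρ).mulVecLin γ.left.toAdd +
        ((genMatrix ρ ^ γ.right.toAdd.val).mulVec u - u) := by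
      rw [Matrix.mulVecLin_apply, Matrix.sub_mulVec, Matrix.one_mulVec, eq_sub_of_add_eq' hl]
      abel
    rw [this]
    exact add_mem ⟨_, rfl⟩ (Matrix.pow_mulVec_sub_mem_range _ _ _)
  · rintro ⟨w, hw⟩
    refine ⟨SemidirectProduct.inl (ofAdd w), ?_⟩
    have heq : SemidirectProduct.inl (ofAdd w) * lift ρ u * (SemidirectProduct.inl (ofAdd w))⁻¹ =
        lift ρ v := by
      rw [mul_inv_eq_iff_eq_mul]
      ext1
      · rw [← toAdd.injective.eq_iff, toAdd_mul_left, toAdd_mul_left]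
        change w + ((ρ 1 : Matrix.GeneralLinearGroup (Fin n) ℤ) :
          Matrix (Fin n) (Fin n) ℤ).mulVec u = v + (genMatrix ρ).mulVec w
        rw [Matrix.mulVecLin_apply, Matrix.sub_mulVec, Matrix.one_mulVec] at hw
        rw [map_one, Units.val_one, Matrix.one_mulVec, eq_add_of_sub_eq hw.symm]
        abel
      · simp [lift]
    change (Subgroup.zpowers (lift ρ u)).map _ = Subgroup.zpowers (lift ρ v)
    rw [MonoidHom.map_zpowers, ← heq]
    rfl

theorem surjective_mk_zpowersLift [Fact p.Prime] :
    Function.Surjective fun u => Quot.mk ConjRel (zpowersLift hfree u) := by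
  rintro ⟨P, hP, hfin⟩
  obtain ⟨u, rfl⟩ := exists_eq_zpowers_lift hP
  exact ⟨u, rfl⟩

/-- Conjugacy classes of nontrivial finite subgroups of `Γ` correspond to the coinvariants of
`ℤⁿ`. -/
noncomputable def quotientEquiv [Fact p.Prime] :
    ((Fin n → ℤ) ⧸ LinearMap.range (1 - genMatrix ρ).mulVecLin) ≃
      Quot (ConjRel (G := Gamma ρ)) :=
  have hmk (u v : Fin n → ℤ) :
      Quot.mk ConjRel (zpowersLift hfree u) = Quot.mk ConjRel (zpowersLift hfree v) ↔
        v - u ∈ LinearMap.range (1 - genMatrix ρ).mulVecLin := by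
    rw [equivalence_conjRel.quot_mk_eq_iff, conjRel_zpowersLift_iff]
  Equiv.ofBijective
    (Quotient.lift (fun u => Quot.mk ConjRel (zpowersLift hfree u)) fun u v h => by
      rw [hmk, ← Submodule.neg_mem_iff, neg_sub]
      exact (Submodule.quotientRel_def _).mp h)
    ⟨by
      rintro ⟨u⟩ ⟨v⟩ h
      refine (Submodule.Quotient.eq _).mpr ?_
      rw [← Submodule.neg_mem_iff, neg_sub]
      exact (hmk u v).mp h,
    fun P => (surjective_mk_zpowersLift hfree P).imp' (Submodule.Quotient.mk) fun _ h => h⟩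

theorem card_quot_conjRel [Fact p.Prime] :
    Nat.card (Quot (ConjRel (G := Gamma ρ))) ^ (p - 1) = p ^ n := by
  have hinj : Function.Injective (1 - genMatrix ρ).mulVecLin := by
    rw [injective_iff_map_eq_zero]
    intro v hv
    rw [Matrix.mulVecLin_apply, Matrix.sub_mulVec, Matrix.one_mulVec, sub_eq_zero] at hv
    exact hfree v hv.symm
  rw [← Nat.card_congr (quotientEquiv hfree), Matrix.card_quotient_range_mulVecLin _ hinj,
    Matrix.natAbs_det_one_sub_pow_of_geom_sum_eq_zero Fact.out _
      (geom_sum_genMatrix_eq_zero hfree), Fintype.card_fin]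

end Gamma

/-- The set `𝒫` of conjugacy classes of nontrivial finite subgroups of `Γ = ℤⁿ ⋊_ρ ℤ/p` is
finite with exactly `p^k` elements. -/
theorem card_conjugacy_classes_of_finite_subgroups (p n k : ℕ) (hp : p.Prime) (hodd : Odd p)
    (hk : 0 < k) (hn : n = k * (p - 1))
    (ρ : Multiplicative (ZMod p) →* Matrix.GeneralLinearGroup (Fin n) ℤ)
    (hfree : ∀ g : Multiplicative (ZMod p), g ≠ 1 → ∀ v : Fin n → ℤ,
      (ρ g : Matrix (Fin n) (Fin n) ℤ).mulVec v = v → v = 0) :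
    Finite (Quot (ConjRel (G := Gamma ρ))) ∧
      Nat.card (Quot (ConjRel (G := Gamma ρ))) = p ^ k := by
  have := Fact.mk hp
  have hcard := Gamma.card_quot_conjRel (hfree (ofAdd 1) (by
    rw [Ne, ofAdd_eq_one]
    exact one_ne_zero))
  replace hcard := hcard.trans ((congrArg (p ^ ·) hn).trans (pow_mul p k (p - 1)))
  have h : Nat.card (Quot (ConjRel (G := Gamma ρ))) = p ^ k :=
    Nat.pow_left_injective (Nat.sub_ne_zero_of_lt hp.one_lt) hcard
  exact ⟨Nat.finite_of_card_ne_zero (h ▸ pow_ne_zero k hp.ne_zero), h⟩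
end

section
/- The fixed-point set of the induced ℤ/p-action on the torus T^n = ℝ^n/ℤ^n is in bijection with the cokernel of ρ(s) - id : ℤ^n → ℤ^n; in particular it consists of exactly p^k points. -/
/-- The standard lattice `ℤⁿ ⊆ ℝⁿ` as an additive subgroup. -/
noncomputable def intLattice (n : ℕ) : AddSubgroup (Fin n → ℝ) :=
  ((Int.castAddHom ℝ).compLeft (Fin n)).range

/-- The torus `Tⁿ = ℝⁿ/ℤⁿ`. -/
noncomputable abbrev Torus (n : ℕ) : Type := (Fin n → ℝ) ⧸ intLattice n

/-- The fixed-point set of the `ℤ/p`-action on `Tⁿ = ℝⁿ/ℤⁿ` induced by `ρ`: a point `x` of the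
torus is fixed iff for every `g` and every lift `y` of `x`, the class of `ρ(g)y` is again `x`. -/
def torusFixedPoints (p n : ℕ)
    (ρ : Multiplicative (ZMod p) →* Matrix.GeneralLinearGroup (Fin n) ℤ) :
    Set (Torus n) :=
  {x | ∀ g : Multiplicative (ZMod p), ∀ y : Fin n → ℝ,
    (QuotientAddGroup.mk y : Torus n) = x →
      (QuotientAddGroup.mk (((ρ g : Matrix (Fin n) (Fin n) ℤ).map
        (Int.cast : ℤ → ℝ)).mulVec y) : Torus n) = x}

open Polynomial in
/-- An integer matrix of size `k * (p - 1)` annihilated by the `p`-th cyclotomic polynomial has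
characteristic polynomial `(cyclotomic p ℚ) ^ k`. -/
lemma charpoly_map_eq_cyclotomic_pow {ι : Type*} [Fintype ι] [DecidableEq ι] {p k : ℕ}
    (hp : p.Prime) (A : Matrix ι ι ℤ) (hA : aeval A (cyclotomic p ℤ) = 0)
    (hcard : Fintype.card ι = k * (p - 1)) :
    A.charpoly.map (Int.castRingHom ℚ) = cyclotomic p ℚ ^ k := by
  have hmonic := A.charpoly_monic.map (Int.castRingHom ℚ)
  have hirr := cyclotomic.irreducible_rat hp.pos
  obtain ⟨m, q, hq, hfac⟩ := WfDvdMonoid.max_power_factor hmonic.ne_zero hirr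
  have hq_monic : q.Monic :=
    ((cyclotomic.monic p ℚ).pow m).of_mul_monic_left (hfac ▸ hmonic)
  have hq_one : q = 1 := by
    by_contra hne
    obtain ⟨μ, hμ⟩ := IsAlgClosed.exists_aeval_eq_zero ℂ q
      (fun h => hne (hq_monic.natDegree_eq_zero.mp (natDegree_eq_of_degree_eq_some h)))
    set B : Matrix ι ι ℂ := (Int.castRingHom ℂ).mapMatrix A with hB
    have hroot : B.charpoly.IsRoot μ := by
      have h : aeval μ (A.charpoly.map (Int.castRingHom ℚ)) = 0 := by
        rw [hfac, map_mul, hμ, mul_zero]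
      rw [IsRoot, hB, RingHom.mapMatrix_apply, Matrix.charpoly_map]
      rw [aeval_def, eval₂_map] at h
      rw [eval_map, ← h]
      congr 1
    have hB0 : aeval B (cyclotomic p ℂ) = 0 := by
      rw [aeval_def, ← map_cyclotomic_int p ℂ, eval₂_map]
      have h := congrArg (Int.castRingHom ℂ).mapMatrix hA
      rw [aeval_def, hom_eval₂, map_zero] at h
      rw [← h]
      congr 1
      exact RingHom.ext_int _ _
    have hspec : eval μ (cyclotomic p ℂ) ∈ spectrum ℂ (0 : Matrix ι ι ℂ) := by
      have : Nonempty ι := by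
        by_contra hempty
        rw [not_nonempty_iff] at hempty
        simp [Matrix.charpoly, Matrix.det_isEmpty] at hroot
      rw [← hB0]
      exact spectrum.subset_polynomial_aeval B _
        ⟨μ, Matrix.mem_spectrum_of_isRoot_charpoly hroot, rfl⟩
    have hcyc : aeval μ (cyclotomic p ℚ) = 0 := by
      rw [aeval_def, ← eval_map, map_cyclotomic]
      by_contra hne
      rw [spectrum.mem_iff, sub_zero] at hspec
      exact hspec ((isUnit_iff_ne_zero.mpr hne).map (algebraMap ℂ (Matrix ι ι ℂ)))
    obtain ⟨a, b, hab⟩ := hirr.coprime_iff_not_dvd.mpr hq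
    have h := congrArg (aeval μ) hab
    simp [hμ, hcyc] at h
  rw [hq_one, mul_one] at hfac
  have hdeg := congrArg natDegree hfac
  rw [A.charpoly_monic.natDegree_map, Matrix.charpoly_natDegree_eq_dim, natDegree_pow,
    natDegree_cyclotomic, Nat.totient_prime hp, hcard] at hdeg
  rw [hfac, Nat.eq_of_mul_eq_mul_right (Nat.sub_pos_of_lt hp.one_lt) hdeg]

open Polynomial in
lemma det_one_sub_eq_prime_pow {ι : Type*} [Fintype ι] [DecidableEq ι] {p k : ℕ}
    (hp : p.Prime) (A : Matrix ι ι ℤ) (hA : aeval A (cyclotomic p ℤ) = 0)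
    (hcard : Fintype.card ι = k * (p - 1)) :
    (1 - A).det = (p : ℤ) ^ k := by
  have := Fact.mk hp
  have h := congrArg (eval 1) (charpoly_map_eq_cyclotomic_pow hp A hA hcard)
  rw [eval_pow, eval_one_cyclotomic_prime, eval_one_map, Matrix.eval_charpoly] at h
  rw [map_one, eq_intCast] at h
  exact_mod_cast h

lemma card_quotient_range_mulVecLin {ι : Type*} [Fintype ι] [DecidableEq ι]
    (B : Matrix ι ι ℤ) (hB : B.det ≠ 0) :
    Nat.card ((ι → ℤ) ⧸ LinearMap.range B.mulVecLin) = B.det.natAbs := by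
  have hinj : Function.Injective B.mulVecLin := Matrix.mulVec_injective_of_det_ne_zero hB
  have h := Submodule.natAbs_det_equiv (LinearMap.range B.mulVecLin)
    (LinearEquiv.ofInjective B.mulVecLin hinj)
  have hcomp : (LinearMap.range B.mulVecLin).subtype ∘ₗ
      ((LinearEquiv.ofInjective B.mulVecLin hinj : _ ≃ₗ[ℤ] _) : _ →ₗ[ℤ] _) = B.mulVecLin := by
    ext; rfl
  have hdet : LinearMap.det B.mulVecLin = B.det := LinearMap.det_toLin' B
  rw [← hdet, ← hcomp]
  exact h.symm

lemma mem_intLattice {n : ℕ} {y : Fin n → ℝ} :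
    y ∈ intLattice n ↔ ∃ v : Fin n → ℤ, (fun i => (v i : ℝ)) = y :=
  Iff.rfl

lemma map_intCast_mulVec {n : ℕ} (M : Matrix (Fin n) (Fin n) ℤ) (v : Fin n → ℤ) :
    (M.map (Int.cast : ℤ → ℝ)).mulVec (fun i => (v i : ℝ)) = fun i => ((M.mulVec v i : ℤ) : ℝ) := by
  ext i
  simp [Matrix.mulVec, dotProduct]

lemma mulVec_mem_intLattice {n : ℕ} (M : Matrix (Fin n) (Fin n) ℤ) {y : Fin n → ℝ}
    (hy : y ∈ intLattice n) : (M.map (Int.cast : ℤ → ℝ)).mulVec y ∈ intLattice n := by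
  obtain ⟨v, rfl⟩ := mem_intLattice.mp hy
  exact mem_intLattice.mpr ⟨M.mulVec v, (map_intCast_mulVec M v).symm⟩

/-- A point of the torus is fixed by the whole group iff it is fixed by a generator. -/
lemma mk_mem_torusFixedPoints_iff {p n : ℕ}
    (ρ : Multiplicative (ZMod p) →* Matrix.GeneralLinearGroup (Fin n) ℤ)
    {g : Multiplicative (ZMod p)} (hg : ∀ x, x ∈ Submonoid.powers g) (y : Fin n → ℝ) :
    (QuotientAddGroup.mk y : Torus n) ∈ torusFixedPoints p n ρ ↔
      (((ρ g : Matrix (Fin n) (Fin n) ℤ) - 1).map (Int.cast : ℤ → ℝ)).mulVec y ∈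
        intLattice n := by
  have hsub (M : Matrix (Fin n) (Fin n) ℤ) (z : Fin n → ℝ) :
      ((M - 1).map (Int.cast : ℤ → ℝ)).mulVec z = (M.map (Int.cast : ℤ → ℝ)).mulVec z - z := by
    rw [Matrix.map_sub _ (by simp), Matrix.map_one _ (by simp) (by simp), Matrix.sub_mulVec,
      Matrix.one_mulVec]
  rw [hsub]
  constructor
  · intro h
    have := h g y rfl
    rw [QuotientAddGroup.eq, neg_add_eq_sub, ← neg_mem_iff, neg_sub] at this
    exact this
  · rintro h x z hz
    obtain ⟨m, rfl⟩ := hg x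
    rw [← hz, QuotientAddGroup.eq, neg_add_eq_sub, ← neg_mem_iff, neg_sub]
    rw [QuotientAddGroup.eq, neg_add_eq_sub] at hz
    have hgz : ((ρ g : Matrix (Fin n) (Fin n) ℤ).map (Int.cast : ℤ → ℝ)).mulVec z - z ∈
        intLattice n := by
      have h' := sub_mem h (sub_mem (mulVec_mem_intLattice (ρ g) hz) hz)
      rw [Matrix.mulVec_sub] at h'
      convert h' using 1
      abel
    have hpow (m : ℕ) : (((ρ g : Matrix (Fin n) (Fin n) ℤ) ^ m).map
        (Int.cast : ℤ → ℝ)).mulVec z - z ∈ intLattice n := by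
      induction m with
      | zero => simp [Matrix.map_one]
      | succ m ih =>
        have hmul : ((ρ g : Matrix (Fin n) (Fin n) ℤ) ^ (m + 1)).map (Int.cast : ℤ → ℝ) =
            (ρ g : Matrix (Fin n) (Fin n) ℤ).map (Int.cast : ℤ → ℝ) *
              ((ρ g : Matrix (Fin n) (Fin n) ℤ) ^ m).map (Int.cast : ℤ → ℝ) := by
          rw [pow_succ']
          exact Matrix.map_mul (f := Int.castRingHom ℝ)
        have h' := add_mem (mulVec_mem_intLattice (ρ g) ih) hgz
        rw [hmul, ← Matrix.mulVec_mulVec]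
        rw [Matrix.mulVec_sub] at h'
        convert h' using 1
        abel
    simpa using hpow m

open Polynomial in
/-- If `A ^ p = 1` and `A` has no nonzero fixed vector, then the `p`-th cyclotomic polynomial
annihilates `A`. -/
lemma aeval_cyclotomic_eq_zero {ι : Type*} [Fintype ι] [DecidableEq ι] {p : ℕ} (hp : p.Prime)
    (A : Matrix ι ι ℤ) (hpow : A ^ p = 1) (hfix : ∀ v, A.mulVec v = v → v = 0) :
    aeval A (cyclotomic p ℤ) = 0 := by
  have := Fact.mk hp
  have hN : aeval A (cyclotomic p ℤ) = ∑ i ∈ Finset.range p, A ^ i := by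
    simp [cyclotomic_prime]
  have hmul : A * aeval A (cyclotomic p ℤ) = aeval A (cyclotomic p ℤ) := by
    rw [← sub_eq_zero, hN, ← sub_one_mul, mul_geom_sum, hpow, sub_self]
  refine Matrix.toLin'.injective (LinearMap.ext fun v => ?_)
  rw [map_zero, LinearMap.zero_apply, Matrix.toLin'_apply]
  exact hfix _ (by rw [Matrix.mulVec_mulVec, hmul])

/-- For an invertible matrix `B`, the cokernel of `B` on `ℤⁿ` is identified by `B⁻¹` with the
kernel of the endomorphism of the torus `ℝⁿ/ℤⁿ` induced by `B`. -/
lemma nonempty_equiv_cokernel {n : ℕ} (B : Matrix (Fin n) (Fin n) ℤ) (hB : B.det ≠ 0)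
    (S : Set (Torus n))
    (hS : ∀ y : Fin n → ℝ, (QuotientAddGroup.mk y : Torus n) ∈ S ↔
      (B.map (Int.cast : ℤ → ℝ)).mulVec y ∈ intLattice n) :
    Nonempty (S ≃ ((Fin n → ℤ) ⧸ LinearMap.range B.mulVecLin)) := by
  set C : Matrix (Fin n) (Fin n) ℝ := B.map (Int.cast : ℤ → ℝ) with hC
  have hdet : IsUnit C.det := by
    have h : C.det = (B.det : ℝ) := ((Int.castRingHom ℝ).map_det B).symm
    rw [h, isUnit_iff_ne_zero]
    exact_mod_cast hB
  let f : (Fin n → ℤ) →+ Torus n :=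
    (QuotientAddGroup.mk' (intLattice n)).comp
      ((C⁻¹.mulVecLin.toAddMonoidHom).comp ((Int.castAddHom ℝ).compLeft (Fin n)))
  have hf (v : Fin n → ℤ) :
      f v = QuotientAddGroup.mk (C⁻¹.mulVec fun i => (v i : ℝ)) := rfl
  have hker : (LinearMap.range B.mulVecLin).toAddSubgroup = f.ker := by
    ext v
    rw [AddMonoidHom.mem_ker, hf, QuotientAddGroup.eq_zero_iff, mem_intLattice]
    constructor
    · rintro ⟨w, rfl⟩
      refine ⟨w, ?_⟩
      rw [Matrix.mulVecLin_apply, ← map_intCast_mulVec, ← hC, Matrix.mulVec_mulVec,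
        Matrix.nonsing_inv_mul _ hdet, Matrix.one_mulVec]
    · rintro ⟨w, hw⟩
      refine ⟨w, ?_⟩
      have h := congrArg C.mulVec hw
      rw [Matrix.mulVec_mulVec, Matrix.mul_nonsing_inv _ hdet, Matrix.one_mulVec, hC,
        map_intCast_mulVec] at h
      ext i
      exact_mod_cast congrFun h i
  have hrange : (f.range : Set (Torus n)) = S := by
    ext x
    obtain ⟨y, rfl⟩ := QuotientAddGroup.mk_surjective x
    rw [hS]
    constructor
    · rintro ⟨v, hv⟩
      rw [← hS, ← hv, hf, hS, Matrix.mulVec_mulVec, Matrix.mul_nonsing_inv _ hdet,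
        Matrix.one_mulVec]
      exact mem_intLattice.mpr ⟨v, rfl⟩
    · intro h
      obtain ⟨v, hv⟩ := mem_intLattice.mp h
      refine ⟨v, ?_⟩
      rw [hf, hv, Matrix.mulVec_mulVec, Matrix.nonsing_inv_mul _ hdet, Matrix.one_mulVec]
  exact ⟨(Equiv.setCongr hrange.symm).trans
    ((QuotientAddGroup.quotientKerEquivRange f).symm.trans
      (QuotientAddGroup.quotientAddEquivOfEq hker.symm)).toEquiv⟩

/-- The fixed-point set of the `ℤ/p`-action on the torus `Tⁿ = ℝⁿ/ℤⁿ` is in bijection with the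
cokernel of `ρ(s) - id : ℤⁿ → ℤⁿ`; in particular it consists of exactly `p^k` points. -/
theorem torus_fixed_points_equiv_cokernel (p n k : ℕ) (hp : p.Prime) (hodd : Odd p)
    (hk : 0 < k) (hn : n = k * (p - 1))
    (ρ : Multiplicative (ZMod p) →* Matrix.GeneralLinearGroup (Fin n) ℤ)
    (hfree : ∀ g : Multiplicative (ZMod p), g ≠ 1 → ∀ v : Fin n → ℤ,
      (ρ g : Matrix (Fin n) (Fin n) ℤ).mulVec v = v → v = 0)
    (s : ZMod p) (hs : addOrderOf s = p) :
    Nonempty (torusFixedPoints p n ρ ≃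
        ((Fin n → ℤ) ⧸ LinearMap.range
          (Matrix.mulVecLin
            ((ρ (Multiplicative.ofAdd s) : Matrix (Fin n) (Fin n) ℤ) - 1)))) ∧
      Nat.card (torusFixedPoints p n ρ) = p ^ k := by
  have : NeZero p := ⟨hp.ne_zero⟩
  set g := Multiplicative.ofAdd s
  set A : Matrix (Fin n) (Fin n) ℤ := ↑(ρ g) with hA
  have hg : orderOf g = p := by rw [orderOf_ofAdd_eq_addOrderOf, hs]
  have hg_ne : g ≠ 1 := fun h => hp.ne_one (by rw [← hg, h, orderOf_one])
  have hpowers (x : Multiplicative (ZMod p)) : x ∈ Submonoid.powers g :=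
    by
    have := Fact.mk hp
    exact mem_powers_of_prime_card (p := p) (by simp) hg_ne
  have hA_pow : A ^ p = 1 := by
    rw [hA, ← Units.val_pow_eq_pow_val, ← map_pow,
      orderOf_dvd_iff_pow_eq_one.mp hg.dvd, map_one, Units.val_one]
  have hdet := det_one_sub_eq_prime_pow (k := k) hp A
    (aeval_cyclotomic_eq_zero hp A hA_pow (hfree g hg_ne)) (by rw [Fintype.card_fin, hn])
  have hnatAbs : (A - 1).det.natAbs = p ^ k := by
    rw [← neg_sub, Matrix.det_neg, hdet]
    simp [Int.natAbs_mul, Int.natAbs_pow]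
  have hdet_ne : (A - 1).det ≠ 0 := by
    rw [← Int.natAbs_ne_zero, hnatAbs]
    exact pow_ne_zero k hp.ne_zero
  have he := nonempty_equiv_cokernel (A - 1) hdet_ne (torusFixedPoints p n ρ)
    (mk_mem_torusFixedPoints_iff ρ hpowers)
  refine ⟨he, ?_⟩
  rw [Nat.card_congr he.some, card_quotient_range_mulVecLin _ hdet_ne, hnatAbs]
end

section
/- The abelianization Γ_ab = Γ/[Γ,Γ] is isomorphic to coker(ρ(s) - id : ℤ^n → ℤ^n) ⊕ ℤ/p, and hence to (ℤ/p)^{k+1}. -/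
open Multiplicative

open Polynomial in
/-- If the norm element `1 + A + ⋯ + A^(p-1)` vanishes, then the characteristic polynomial of `A`
divides a power of the `p`-th cyclotomic polynomial. -/
theorem charpoly_dvd_cyclotomic_pow {p n : ℕ} [Fact p.Prime] (A : Matrix (Fin n) (Fin n) ℤ)
    (hA : ∑ i ∈ Finset.range p, A ^ i = 0) :
    A.charpoly ∣ cyclotomic p ℤ ^ n := by
  have hcomm : Commute (Matrix.scalar (Fin n) (X : ℤ[X])) ((C : ℤ →+* ℤ[X]).mapMatrix A) :=
    Matrix.scalar_commute _ (fun _ => Commute.all _ _) _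
  have hdvd : A.charmatrix ∣ Matrix.scalar (Fin n) (cyclotomic p ℤ) := by
    have key : Matrix.scalar (Fin n) (cyclotomic p ℤ) =
        ∑ i ∈ Finset.range p, (Matrix.scalar (Fin n) (X : ℤ[X]) ^ i -
          ((C : ℤ →+* ℤ[X]).mapMatrix A) ^ i) := by
      rw [Finset.sum_sub_distrib, cyclotomic_prime, map_sum]
      simp only [← map_pow]
      rw [← map_sum (C : ℤ →+* ℤ[X]).mapMatrix, hA, map_zero, sub_zero]
    rw [key]
    exact Finset.dvd_sum fun i _ => hcomm.sub_dvd_pow_sub_pow i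
  obtain ⟨Q, hQ⟩ := hdvd
  refine ⟨Q.det, ?_⟩
  rw [Matrix.charpoly, ← Matrix.det_mul, ← hQ]
  simp

open Polynomial in
theorem natAbs_det_sub_one {p n k : ℕ} [Fact p.Prime] (hn : n = k * (p - 1))
    (A : Matrix (Fin n) (Fin n) ℤ) (hA : ∑ i ∈ Finset.range p, A ^ i = 0) :
    (A - 1).det.natAbs = p ^ k := by
  have hp : p.Prime := Fact.out
  have hprime : Prime (cyclotomic p ℤ) := (cyclotomic.irreducible hp.pos).prime
  obtain ⟨i, -, hi⟩ := (dvd_prime_pow hprime n).1 (charpoly_dvd_cyclotomic_pow A hA)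
  have heq : A.charpoly = cyclotomic p ℤ ^ i :=
    eq_of_monic_of_associated A.charpoly_monic ((cyclotomic.monic p ℤ).pow i) hi
  have hdeg := congrArg natDegree heq
  rw [Matrix.charpoly_natDegree_eq_dim, natDegree_pow, natDegree_cyclotomic,
    Nat.totient_prime hp, Fintype.card_fin, hn] at hdeg
  have hik : k = i := Nat.eq_of_mul_eq_mul_right (Nat.sub_pos_of_lt hp.one_lt) hdeg
  have hev := congrArg (eval 1) heq
  rw [Matrix.eval_charpoly, eval_pow, eval_one_cyclotomic_prime, map_one] at hev
  rw [← neg_sub, Matrix.det_neg, hev, hik]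
  simp [Int.natAbs_mul, Int.natAbs_pow]

/-- If the norm element `1 + A + ⋯ + A^(p-1)` vanishes, then `p` kills the cokernel of `A - 1`. -/
theorem nsmul_mem_range_sub_one {p n : ℕ} (A : Matrix (Fin n) (Fin n) ℤ)
    (hA : ∑ i ∈ Finset.range p, A ^ i = 0) (v : Fin n → ℤ) :
    p • v ∈ LinearMap.range (A - 1).mulVecLin := by
  have hdvd : A - 1 ∣ ∑ i ∈ Finset.range p, (A ^ i - 1) :=
    Finset.dvd_sum fun i _ => by simpa using (Commute.one_right A).sub_dvd_pow_sub_pow i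
  obtain ⟨Q, hQ⟩ := hdvd
  rw [Finset.sum_sub_distrib, hA] at hQ
  refine ⟨-(Q.mulVec v), ?_⟩
  rw [Matrix.mulVecLin_apply, Matrix.mulVec_neg, Matrix.mulVec_mulVec, ← hQ]
  simp [Matrix.neg_mulVec, ← Nat.cast_smul_eq_nsmul ℤ]

theorem card_coker_mulVecLin {n : ℕ} (D : Matrix (Fin n) (Fin n) ℤ) (hD : D.det ≠ 0) :
    Nat.card ((Fin n → ℤ) ⧸ LinearMap.range D.mulVecLin) = D.det.natAbs := by
  have hinj : Function.Injective D.mulVecLin := Matrix.mulVec_injective_of_det_ne_zero hD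
  have h := Submodule.natAbs_det_equiv (LinearMap.range D.mulVecLin)
    (LinearEquiv.ofInjective D.mulVecLin hinj)
  rw [← h, ← LinearMap.det_toLin']
  rfl

theorem nonempty_linearEquiv_of_card_eq_pow {p k : ℕ} [Fact p.Prime] {V : Type*} [AddCommGroup V]
    [Module (ZMod p) V] (hcard : Nat.card V = p ^ k) :
    Nonempty (V ≃ₗ[ZMod p] (Fin k → ZMod p)) := by
  have hp : p.Prime := Fact.out
  have : Finite V := Nat.finite_of_card_ne_zero (hcard ▸ pow_ne_zero _ hp.ne_zero)
  have h := Module.natCard_eq_pow_finrank (K := ZMod p) (V := V)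
  rw [hcard, Nat.card_zmod] at h
  have hrank : Module.finrank (ZMod p) V = k := (Nat.pow_right_injective hp.two_le h).symm
  exact ⟨LinearEquiv.ofFinrankEq _ _ (by simpa using hrank)⟩

/-- An abelian group of order `p ^ k` and exponent dividing `p` is elementary abelian. -/
theorem nonempty_addEquiv_of_card_eq_pow {p k : ℕ} [Fact p.Prime] {V : Type*} [AddCommGroup V]
    (hV : ∀ x : V, p • x = 0) (hcard : Nat.card V = p ^ k) :
    Nonempty (V ≃+ (Fin k → ZMod p)) := by
  let _ : Module (ZMod p) V := AddCommGroup.zmodModule hV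
  obtain ⟨e⟩ := nonempty_linearEquiv_of_card_eq_pow (p := p) hcard
  exact ⟨e.toAddEquiv⟩

theorem nonempty_coker_addEquiv {p n k : ℕ} [Fact p.Prime] (hn : n = k * (p - 1))
    (A : Matrix (Fin n) (Fin n) ℤ) (hA : ∑ i ∈ Finset.range p, A ^ i = 0) :
    Nonempty (((Fin n → ℤ) ⧸ LinearMap.range (A - 1).mulVecLin) ≃+ (Fin k → ZMod p)) := by
  have hp : p.Prime := Fact.out
  have hdet := natAbs_det_sub_one hn A hA
  have hcard := card_coker_mulVecLin (A - 1) (by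
    rw [← Int.natAbs_ne_zero, hdet]; exact pow_ne_zero _ hp.ne_zero)
  rw [hdet] at hcard
  refine nonempty_addEquiv_of_card_eq_pow (fun x => ?_) hcard
  obtain ⟨v, rfl⟩ := Submodule.mkQ_surjective _ x
  rw [← map_nsmul, Submodule.mkQ_apply, Submodule.Quotient.mk_eq_zero]
  exact nsmul_mem_range_sub_one A hA v

/-- If `A` has order dividing `p` and fixes only the origin, then its norm element vanishes. -/
theorem geom_sum_eq_zero_of_fixed_eq_zero {p n : ℕ} (A : Matrix (Fin n) (Fin n) ℤ) (hA : A ^ p = 1)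
    (hfix : ∀ v : Fin n → ℤ, A.mulVec v = v → v = 0) :
    ∑ i ∈ Finset.range p, A ^ i = 0 := by
  have hmul : A * ∑ i ∈ Finset.range p, A ^ i = ∑ i ∈ Finset.range p, A ^ i := by
    rw [← sub_eq_zero, ← sub_one_mul, mul_geom_sum, hA, sub_self]
  refine Matrix.ext_iff_mulVec.2 fun v => ?_
  rw [Matrix.zero_mulVec]
  exact hfix _ (by rw [Matrix.mulVec_mulVec, hmul])

theorem pow_mulVec_sub_mem_range {n : ℕ} (A : Matrix (Fin n) (Fin n) ℤ) (m : ℕ) (v : Fin n → ℤ) :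
    (A ^ m).mulVec v - v ∈ LinearMap.range (A - 1).mulVecLin := by
  obtain ⟨Q, hQ⟩ : A - 1 ∣ A ^ m - 1 := by
    simpa using (Commute.one_right A).sub_dvd_pow_sub_pow m
  refine ⟨Q.mulVec v, ?_⟩
  rw [Matrix.mulVecLin_apply, Matrix.mulVec_mulVec, ← hQ, Matrix.sub_mulVec, Matrix.one_mulVec]

theorem exists_pow_ofAdd_eq {p : ℕ} [NeZero p] {s : ZMod p} (hs : addOrderOf s = p)
    (g : Multiplicative (ZMod p)) : ∃ m : ℕ, ofAdd s ^ m = g := by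
  have htop : AddSubgroup.zmultiples s = ⊤ := by
    rw [← AddSubgroup.card_eq_iff_eq_top, Nat.card_zmultiples, hs, Nat.card_zmod]
  have hg : g.toAdd ∈ AddSubgroup.zmultiples s := htop ▸ AddSubgroup.mem_top _
  obtain ⟨m, hm⟩ := (mem_zmultiples_iff_mem_range_addOrderOf.1 hg) |> Finset.mem_image.1
  exact ⟨m, by rw [← ofAdd_nsmul, hm.2, ofAdd_toAdd]⟩

section Abelianization

open scoped commutatorElement

variable {p n : ℕ} (ρ : Multiplicative (ZMod p) →* Matrix.GeneralLinearGroup (Fin n) ℤ)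

/-- The projection `ℤⁿ ⋊ ℤ/p → coker(ρ(s) - 1) × ℤ/p`. -/
def gammaToCokerProd [NeZero p] {s : ZMod p} (hs : addOrderOf s = p) :
    Gamma ρ →* Multiplicative
      (((Fin n → ℤ) ⧸ LinearMap.range (Matrix.mulVecLin
        ((ρ (Multiplicative.ofAdd s) : Matrix (Fin n) (Fin n) ℤ) - 1))) × ZMod p) where
  toFun x := ofAdd (Submodule.Quotient.mk x.left.toAdd, x.right.toAdd)
  map_one' := rfl
  map_mul' x y := by
    obtain ⟨m, hm⟩ := exists_pow_ofAdd_eq hs x.right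
    have h := pow_mulVec_sub_mem_range (ρ (ofAdd s) : Matrix (Fin n) (Fin n) ℤ) m y.left.toAdd
    rw [← Units.val_pow_eq_pow_val, ← map_pow, hm, ← Submodule.Quotient.eq] at h
    rw [← ofAdd_add, Prod.mk_add_mk, ← Submodule.Quotient.mk_add]
    refine congrArg ofAdd (Prod.ext ?_ rfl)
    change Submodule.Quotient.mk (x.left.toAdd +
      (ρ x.right : Matrix (Fin n) (Fin n) ℤ).mulVec y.left.toAdd) = _
    rw [Submodule.Quotient.mk_add, h, Submodule.Quotient.mk_add]

theorem gammaToCokerProd_surjective [NeZero p] {s : ZMod p} (hs : addOrderOf s = p) :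
    Function.Surjective (gammaToCokerProd ρ hs) := by
  intro y
  obtain ⟨v, hv⟩ := Submodule.Quotient.mk_surjective _ y.toAdd.1
  exact ⟨⟨ofAdd v, ofAdd y.toAdd.2⟩, congrArg ofAdd (Prod.ext hv rfl)⟩

theorem ker_gammaToCokerProd [NeZero p] {s : ZMod p} (hs : addOrderOf s = p) :
    (gammaToCokerProd ρ hs).ker = commutator (Gamma ρ) := by
  refine le_antisymm (fun x hx => ?_) (Abelianization.commutator_subset_ker _)
  have hx' := congrArg toAdd (MonoidHom.mem_ker.1 hx)
  have hr : x.right = 1 := congrArg Prod.snd hx'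
  obtain ⟨w, hw⟩ := (Submodule.Quotient.mk_eq_zero _).1 (congrArg Prod.fst hx')
  have hcomm : x = ⁅(SemidirectProduct.inr (ofAdd s) : Gamma ρ),
      SemidirectProduct.inl (ofAdd w)⁆ := by
    rw [commutatorElement_def, ← map_inv SemidirectProduct.inr, ← SemidirectProduct.inl_aut,
      ← map_inv, ← map_mul]
    refine SemidirectProduct.ext ?_ hr
    rw [SemidirectProduct.left_inl]
    apply toAdd.injective
    rw [← hw, Matrix.mulVecLin_apply, Matrix.sub_mulVec, Matrix.one_mulVec, sub_eq_add_neg]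
    rfl
  rw [hcomm]
  exact Subgroup.commutator_mem_commutator (Subgroup.mem_top _) (Subgroup.mem_top _)

/-- The abelianization of `ℤⁿ ⋊ ℤ/p` is `coker(ρ(s) - 1) × ℤ/p`. -/
noncomputable def abelianizationGammaEquiv [NeZero p] {s : ZMod p} (hs : addOrderOf s = p) :
    Abelianization (Gamma ρ) ≃* Multiplicative
      (((Fin n → ℤ) ⧸ LinearMap.range (Matrix.mulVecLin
        ((ρ (Multiplicative.ofAdd s) : Matrix (Fin n) (Fin n) ℤ) - 1))) × ZMod p) :=
  (QuotientGroup.quotientMulEquivOfEq (ker_gammaToCokerProd ρ hs).symm).trans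
    (QuotientGroup.quotientKerEquivOfSurjective _ (gammaToCokerProd_surjective ρ hs))

end Abelianization

/-- The abelianization of `Γ = ℤⁿ ⋊_ρ ℤ/p` is isomorphic to
`coker(ρ(s) - id : ℤⁿ → ℤⁿ) ⊕ ℤ/p`, and hence to `(ℤ/p)^{k+1}`. -/
theorem abelianization_iso (p n k : ℕ) (hp : p.Prime) (hodd : Odd p) (hk : 0 < k)
    (hn : n = k * (p - 1))
    (ρ : Multiplicative (ZMod p) →* Matrix.GeneralLinearGroup (Fin n) ℤ)
    (hfree : ∀ g : Multiplicative (ZMod p), g ≠ 1 → ∀ v : Fin n → ℤ,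
      (ρ g : Matrix (Fin n) (Fin n) ℤ).mulVec v = v → v = 0)
    (s : ZMod p) (hs : addOrderOf s = p) :
    Nonempty (Abelianization (Gamma ρ) ≃*
        Multiplicative
          (((Fin n → ℤ) ⧸ LinearMap.range (Matrix.mulVecLin
            ((ρ (Multiplicative.ofAdd s) : Matrix (Fin n) (Fin n) ℤ) - 1))) × ZMod p)) ∧
      Nonempty (Abelianization (Gamma ρ) ≃* Multiplicative (Fin (k + 1) → ZMod p)) := by
  have : Fact p.Prime := ⟨hp⟩
  have e := abelianizationGammaEquiv ρ hs
  refine ⟨⟨e⟩, ?_⟩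
  have hs1 : ofAdd s ≠ 1 := fun h => hp.one_lt.ne' (by
    rw [← hs, ofAdd_eq_one.1 h, addOrderOf_zero])
  have hpow : (ρ (ofAdd s) : Matrix (Fin n) (Fin n) ℤ) ^ p = 1 := by
    rw [← Units.val_pow_eq_pow_val, ← map_pow, ← ofAdd_nsmul,
      addOrderOf_dvd_iff_nsmul_eq_zero.1 hs.dvd, ofAdd_zero, map_one, Units.val_one]
  obtain ⟨f⟩ := nonempty_coker_addEquiv hn _
    (geom_sum_eq_zero_of_fixed_eq_zero _ hpow (hfree _ hs1))
  exact ⟨e.trans (AddEquiv.toMultiplicative ((f.prodCongr (AddEquiv.refl _)).trans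
    (AddEquiv.prodComm.trans (Fin.consLinearEquiv ℤ fun _ => ZMod p).toAddEquiv)))⟩
end

section
/- Let p be an odd prime, let ζ = e^{2πi/p}, and let ℤ/p act on the ring of integers ℤ[ζ] of the p-th cyclotomic field by multiplication by ζ (the generator acts as x ↦ ζx). For 0 ≤ j ≤ p-1, the subgroup of ℤ/p-invariants of the j-th exterior power Λ^j_ℤ(ℤ[ζ]) (with the induced ℤ/p-action) is a free abelian group of rank (1/p)(C(p-1, j) + (-1)^j (p-1)), where C(p-1, j) denotes the binomial coefficient; moreover Λ^j_ℤ(ℤ[ζ]) = 0 for j ≥ p. -/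
set_option synthInstance.maxHeartbeats 1000000
set_option maxHeartbeats 1000000

/-- The `ℤ/p`-invariants of the `j`-th exterior power `Λ^j_ℤ(ℤ[ζ])`, where the generator of
`ℤ/p` acts on `ℤ[ζ]` by multiplication by `ζ` and hence on `Λ^j_ℤ(ℤ[ζ])` by functoriality:
elements of `⋀[ℤ]^j ℤ[ζ]` fixed by the induced map. -/
noncomputable def exteriorInvariants (p j : ℕ) :
    Submodule ℤ (ExteriorAlgebra ℤ (Zzeta p)) :=
  (⋀[ℤ]^j (Zzeta p)) ⊓
    LinearMap.eqLocus
      (ExteriorAlgebra.map (LinearMap.mulLeft ℤ (zetaZ p))).toLinearMap LinearMap.id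

theorem card_powersetCard_filter_sum_eq {p : ℕ} [Fact p.Prime] {j : ℕ} (hj : (j : ZMod p) ≠ 0)
    (t : ZMod p) :
    ((Finset.univ : Finset (ZMod p)).powersetCard j |>.filter fun s ↦ ∑ x ∈ s, x = t).card =
      ((Finset.univ : Finset (ZMod p)).powersetCard j |>.filter fun s ↦ ∑ x ∈ s, x = 0).card := by
  refine Finset.card_nbij' (fun s ↦ s.map (addRightEmbedding (-(t / j))))
    (fun s ↦ s.map (addRightEmbedding (t / j))) ?_ ?_ ?_ ?_
  · intro s hs
    simp only [Finset.coe_filter, Finset.mem_powersetCard_univ, Set.mem_ofPred_eq] at hs ⊢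
    simp [Finset.sum_add_distrib, hs]
    field_simp
    ring
  · intro s hs
    simp only [Finset.coe_filter, Finset.mem_powersetCard_univ, Set.mem_ofPred_eq] at hs ⊢
    simp [Finset.sum_add_distrib, hs]
    field_simp
  · intro s _
    ext x
    simp
  · intro s _
    ext x
    simp

theorem mul_card_powersetCard_filter_sum_eq_zero {p : ℕ} [Fact p.Prime] {j : ℕ}
    (hj : (j : ZMod p) ≠ 0) :
    p * ((Finset.univ : Finset (ZMod p)).powersetCard j |>.filter fun s ↦ ∑ x ∈ s, x = 0).card =
      p.choose j := by
  have h := Finset.card_eq_sum_card_fiberwise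
    (s := (Finset.univ : Finset (ZMod p)).powersetCard j) (t := Finset.univ)
    (f := fun s ↦ ∑ x ∈ s, x) (by simp [Set.MapsTo])
  simp only [card_powersetCard_filter_sum_eq hj] at h
  simpa [ZMod.card] using h.symm

theorem mul_card_powersetCard_erase_filter_sum_eq_zero {p : ℕ} [Fact p.Prime] {j : ℕ}
    (hj : j < p) :
    (p : ℤ) * (((Finset.univ : Finset (ZMod p)).erase 0).powersetCard j |>.filter
        fun s ↦ ∑ x ∈ s, x = 0).card =
      ((p - 1).choose j : ℤ) + (-1) ^ j * ((p : ℤ) - 1) := by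
  induction j with
  | zero => simp [Finset.filter_singleton]
  | succ j ih =>
    have hj' : ((j + 1 : ℕ) : ZMod p) ≠ 0 := by
      rw [Ne, ZMod.natCast_eq_zero_iff]
      exact Nat.not_dvd_of_pos_of_lt j.succ_pos hj
    have h := mul_card_powersetCard_filter_sum_eq_zero hj'
    rw [← Finset.insert_erase (Finset.mem_univ (0 : ZMod p)),
      Finset.powersetCard_succ_insert (Finset.notMem_erase _ _), Finset.filter_union,
      Finset.card_union_of_disjoint, Finset.filter_image, Finset.card_image_of_injOn] at h
    · have hsum : (((Finset.univ : Finset (ZMod p)).erase 0).powersetCard j).filter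
            (fun s ↦ ∑ x ∈ insert 0 s, x = 0) =
          (((Finset.univ : Finset (ZMod p)).erase 0).powersetCard j).filter
            (fun s ↦ ∑ x ∈ s, x = 0) := by
        refine Finset.filter_congr fun s _ ↦ ?_
        rw [Finset.sum_insert_zero (f := fun x : ZMod p ↦ x) rfl]
      rw [hsum] at h
      have hc : p.choose (j + 1) = (p - 1).choose j + (p - 1).choose (j + 1) := by
        rw [← Nat.choose_succ_succ', Nat.sub_add_cancel (by omega)]
      have := ih (by omega)
      rw [hc] at h
      zify at h
      rw [pow_succ]
      linarith
    · intro s hs t ht hst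
      have hs0 : (0 : ZMod p) ∉ s := fun h0 ↦ by
        simpa using (Finset.mem_powersetCard.mp (Finset.mem_filter.mp hs).1).1 h0
      have ht0 : (0 : ZMod p) ∉ t := fun h0 ↦ by
        simpa using (Finset.mem_powersetCard.mp (Finset.mem_filter.mp ht).1).1 h0
      rw [← Finset.erase_insert hs0, ← Finset.erase_insert ht0]
      exact congrArg (fun u : Finset (ZMod p) ↦ u.erase 0) hst
    · refine Finset.disjoint_filter_filter (Finset.disjoint_left.mpr fun s hs hs' ↦ ?_)
      obtain ⟨t, -, rfl⟩ := Finset.mem_image.mp hs'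
      simpa using (Finset.mem_powersetCard.mp hs).1 (Finset.mem_insert_self 0 t)

open Module

theorem exteriorPower.toMatrix_map {R M N I J : Type*} [CommRing R] [AddCommGroup M] [Module R M]
    [AddCommGroup N] [Module R N] [LinearOrder I] [LinearOrder J] [Fintype I] [Fintype J] (n : ℕ)
    (b : Basis I R M) (c : Basis J R N) (f : M →ₗ[R] N)
    (t : Set.powersetCard J n) (s : Set.powersetCard I n) :
    LinearMap.toMatrix (b.exteriorPower n) (c.exteriorPower n) (exteriorPower.map n f) t s =
      ((LinearMap.toMatrix b c f).submatrix (Set.powersetCard.ofFinEmbEquiv.symm t)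
        (Set.powersetCard.ofFinEmbEquiv.symm s)).det := by
  rw [LinearMap.toMatrix_apply, exteriorPower.basis_apply, exteriorPower.map_apply_ιMulti_family,
    exteriorPower.basis_repr_apply, exteriorPower.ιMulti_family,
    exteriorPower.ιMultiDual_apply_ιMulti, ← Matrix.det_transpose]
  congr 1
  ext i j
  simp [LinearMap.toMatrix_apply]

theorem LinearMap.toMatrix_basis_baseChange {R S M N I J : Type*} [CommRing R] [CommRing S]
    [Algebra R S] [AddCommGroup M] [Module R M] [AddCommGroup N] [Module R N] [Fintype I]
    [DecidableEq I] [Finite J] (b : Basis I R M) (c : Basis J R N) (f : M →ₗ[R] N) :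
    LinearMap.toMatrix (b.baseChange S) (c.baseChange S) (f.baseChange S) =
      (LinearMap.toMatrix b c f).map (algebraMap R S) := by
  ext i j
  simp [LinearMap.toMatrix_apply, Algebra.algebraMap_eq_smul_one]

theorem exteriorPower.toMatrix_map_baseChange {R S M I : Type*} [CommRing R] [CommRing S]
    [Algebra R S] [AddCommGroup M] [Module R M] [LinearOrder I] [Fintype I] (n : ℕ)
    (b : Basis I R M) (f : M →ₗ[R] M) :
    LinearMap.toMatrix ((b.baseChange S).exteriorPower n) ((b.baseChange S).exteriorPower n)
        (exteriorPower.map n (f.baseChange S)) =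
      LinearMap.toMatrix ((b.exteriorPower n).baseChange S) ((b.exteriorPower n).baseChange S)
        ((exteriorPower.map n f).baseChange S) := by
  ext t s
  rw [exteriorPower.toMatrix_map, LinearMap.toMatrix_basis_baseChange,
    LinearMap.toMatrix_basis_baseChange, Matrix.map_apply, exteriorPower.toMatrix_map,
    RingHom.map_det, RingHom.mapMatrix_apply, Matrix.submatrix_map]

theorem LinearMap.finrank_ker_sub_id_add_rank_toMatrix {K V ι : Type*} [Field K]
    [AddCommGroup V] [Module K V] [Fintype ι] [DecidableEq ι] (b : Basis ι K V) (f : V →ₗ[K] V) :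
    finrank K (LinearMap.ker (f - LinearMap.id)) + (LinearMap.toMatrix b b f - 1).rank =
      Fintype.card ι := by
  have := Module.Finite.of_basis b
  rw [← LinearMap.toMatrix_id b, ← map_sub, Matrix.rank_eq_finrank_range_toLin _ b b,
    Matrix.toLin_toMatrix, add_comm, LinearMap.finrank_range_add_finrank_ker,
    finrank_eq_card_basis b]

theorem LinearMap.free_ker {R M N : Type*} [CommRing R] [IsDomain R] [IsPrincipalIdealRing R]
    [AddCommGroup M] [Module R M] [AddCommGroup N] [Module R N] [Module.Free R M]
    [Module.Finite R M] (f : M →ₗ[R] N) : Module.Free R (LinearMap.ker f) :=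
  inferInstance

theorem LinearMap.finrank_ker_baseChange {R M N : Type*} (S : Type*) [CommRing R] [CommRing S]
    [IsDomain R] [IsPrincipalIdealRing R] [Nontrivial S]
    [Algebra R S] [Module.Flat R S] [AddCommGroup M] [Module R M] [AddCommGroup N] [Module R N]
    [Module.Free R M] [Module.Finite R M] (f : M →ₗ[R] N) :
    finrank S (LinearMap.ker (f.baseChange S)) = finrank R (LinearMap.ker f) := by
  rw [← Module.finrank_baseChange (R := S) (S := R)]
  exact (LinearMap.tensorKerEquiv S S f).finrank_eq.symm

theorem exteriorPower.finrank_ker_map_sub_id {R M : Type*} (K : Type*) [CommRing R] [IsDomain R]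
    [IsPrincipalIdealRing R] [Field K] [Algebra R K] [Module.Flat R K] [AddCommGroup M]
    [Module R M] [Module.Free R M] [Module.Finite R M] (n : ℕ) (f : M →ₗ[R] M) :
    finrank R (LinearMap.ker (exteriorPower.map n f - LinearMap.id)) =
      finrank K (LinearMap.ker (exteriorPower.map n (f.baseChange K) - LinearMap.id)) := by
  classical
  let b := Module.finBasis R M
  have h₁ := LinearMap.finrank_ker_sub_id_add_rank_toMatrix ((b.exteriorPower n).baseChange K)
    ((exteriorPower.map n f).baseChange K)
  have h₂ := LinearMap.finrank_ker_sub_id_add_rank_toMatrix ((b.baseChange K).exteriorPower n)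
    (exteriorPower.map n (f.baseChange K))
  rw [exteriorPower.toMatrix_map_baseChange] at h₂
  rw [← LinearMap.finrank_ker_baseChange K, LinearMap.baseChange_sub, LinearMap.baseChange_id]
  omega

theorem exteriorPower.map_ιMulti_family_of_smul {R M I : Type*} [CommRing R] [AddCommGroup M]
    [Module R M] [LinearOrder I] (n : ℕ) {f : M →ₗ[R] M} {v : I → M} {μ : I → R}
    (hv : ∀ i, f (v i) = μ i • v i) (s : Set.powersetCard I n) :
    exteriorPower.map n f (exteriorPower.ιMulti_family R n v s) =
      (∏ i ∈ (s : Finset I), μ i) • exteriorPower.ιMulti_family R n v s := by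
  have hs : f ∘ v ∘ Set.powersetCard.ofFinEmbEquiv.symm s = fun k ↦
      μ (Set.powersetCard.ofFinEmbEquiv.symm s k) • v (Set.powersetCard.ofFinEmbEquiv.symm s k) :=
    funext fun k ↦ hv _
  have hprod : ∏ k, μ (Set.powersetCard.ofFinEmbEquiv.symm s k) = ∏ i ∈ (s : Finset I), μ i := by
    rw [← Finset.map_orderEmbOfFin_univ (s : Finset I) s.prop, Finset.prod_map]
    rfl
  rw [exteriorPower.ιMulti_family, exteriorPower.map_apply_ιMulti, hs,
    AlternatingMap.map_smul_univ, hprod]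
  rfl

theorem exteriorPower.finrank_ker_map_sub_id_of_eigenbasis {K V I : Type*} [Field K]
    [AddCommGroup V] [Module K V] [LinearOrder I] [Fintype I] [DecidableEq K] (n : ℕ)
    {f : V →ₗ[K] V} (v : Basis I K V) {μ : I → K} (hv : ∀ i, f (v i) = μ i • v i) :
    finrank K (LinearMap.ker (exteriorPower.map n f - LinearMap.id)) =
      Fintype.card {s : Set.powersetCard I n // ∏ i ∈ (s : Finset I), μ i = 1} := by
  have h := LinearMap.finrank_ker_sub_id_add_rank_toMatrix (v.exteriorPower n)
    (exteriorPower.map n f)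
  have hdiag : LinearMap.toMatrix (v.exteriorPower n) (v.exteriorPower n)
      (exteriorPower.map n f) =
        Matrix.diagonal fun s : Set.powersetCard I n ↦ ∏ i ∈ (s : Finset I), μ i := by
    ext t s
    rw [LinearMap.toMatrix_apply, exteriorPower.basis_apply,
      exteriorPower.map_ιMulti_family_of_smul n hv, map_smul, exteriorPower.basis_repr]
    rcases eq_or_ne t s with rfl | hts
    · simp
    · simp [hts]
  rw [hdiag, ← Matrix.diagonal_one, Matrix.diagonal_sub, Matrix.rank_diagonal] at h
  have hcompl := Fintype.card_subtype_compl
    fun s : Set.powersetCard I n ↦ ∏ i ∈ (s : Finset I), μ i = 1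
  have hle := Fintype.card_subtype_le
    fun s : Set.powersetCard I n ↦ ∏ i ∈ (s : Finset I), μ i = 1
  simp only [sub_ne_zero] at h
  simp only [← ne_eq] at hcompl
  omega

theorem zetaC_isPrimitiveRoot (p : ℕ) [NeZero p] : IsPrimitiveRoot (zetaC p) p :=
  Complex.isPrimitiveRoot_exp p (NeZero.ne p)

theorem isIntegral_zetaC (p : ℕ) [NeZero p] : IsIntegral ℤ (zetaC p) :=
  (zetaC_isPrimitiveRoot p).isIntegral (NeZero.pos p)

/-- The power basis `1, ζ, ζ², …` of `ℤ[ζ]`. -/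
noncomputable def zzetaPowerBasis (p : ℕ) [NeZero p] : PowerBasis ℤ (Zzeta p) :=
  Algebra.adjoin.powerBasis' (isIntegral_zetaC p)

theorem zzetaPowerBasis_gen (p : ℕ) [NeZero p] : (zzetaPowerBasis p).gen = zetaZ p :=
  Algebra.adjoin.powerBasis'_gen (isIntegral_zetaC p)

instance zzeta_finite (p : ℕ) [NeZero p] : Module.Finite ℤ (Zzeta p) :=
  (zzetaPowerBasis p).finite

instance zzeta_free (p : ℕ) [NeZero p] : Module.Free ℤ (Zzeta p) :=
  Module.Free.of_basis (zzetaPowerBasis p).basis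

theorem charpoly_mulLeft_zetaZ (p : ℕ) [NeZero p] :
    (LinearMap.mulLeft ℤ (zetaZ p)).charpoly = Polynomial.cyclotomic p ℤ := by
  have h := charpoly_leftMulMatrix (zzetaPowerBasis p)
  rw [Algebra.leftMulMatrix_apply, LinearMap.charpoly_toMatrix, zzetaPowerBasis_gen] at h
  rw [Polynomial.cyclotomic_eq_minpoly (zetaC_isPrimitiveRoot p) (NeZero.pos p)]
  refine h.trans ?_
  exact (minpoly.algHom_eq (Zzeta p).val Subtype.val_injective (zetaZ p)).symm

theorem finrank_zzeta (p : ℕ) [NeZero p] : finrank ℤ (Zzeta p) = p.totient := by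
  rw [← LinearMap.charpoly_natDegree (LinearMap.mulLeft ℤ (zetaZ p)),
    charpoly_mulLeft_zetaZ, Polynomial.natDegree_cyclotomic]

theorem isPrimitiveRoot_stdAddChar {p : ℕ} [Fact p.Prime] {a : ZMod p} (ha : a ≠ 0) :
    IsPrimitiveRoot (ZMod.stdAddChar a) p := by
  refine (IsPrimitiveRoot.iff_orderOf).mpr (orderOf_eq_prime ?_ ?_)
  · rw [← AddChar.map_nsmul_eq_pow]
    simp
  · rw [← AddChar.map_zero_eq_one (ZMod.stdAddChar (N := p))]
    exact fun h ↦ ha (ZMod.injective_stdAddChar h)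

theorem exists_eigenbasis_mulLeft_zetaZ {p : ℕ} [Fact p.Prime] :
    ∃ v : Basis {a : ZMod p // a ≠ 0} ℂ (TensorProduct ℤ ℂ (Zzeta p)), ∀ a,
      (LinearMap.mulLeft ℤ (zetaZ p)).baseChange ℂ (v a) = ZMod.stdAddChar a.1 • v a := by
  have hp : p.Prime := Fact.out
  have hev (a : {a : ZMod p // a ≠ 0}) :
      Module.End.HasEigenvalue ((LinearMap.mulLeft ℤ (zetaZ p)).baseChange ℂ)
        (ZMod.stdAddChar a.1) := by
    rw [Module.End.hasEigenvalue_iff_isRoot_charpoly, LinearMap.charpoly_baseChange,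
      charpoly_mulLeft_zetaZ, Polynomial.map_cyclotomic]
    exact (isPrimitiveRoot_stdAddChar a.2).isRoot_cyclotomic hp.pos
  choose v hv using fun a ↦ (hev a).exists_hasEigenvector
  have hinj : Function.Injective fun a : {a : ZMod p // a ≠ 0} ↦ ZMod.stdAddChar a.1 :=
    ZMod.injective_stdAddChar.comp Subtype.val_injective
  have hli := Module.End.eigenvectors_linearIndependent' _ _ hinj v hv
  have hcard : Fintype.card {a : ZMod p // a ≠ 0} = finrank ℂ (TensorProduct ℤ ℂ (Zzeta p)) := by
    rw [Module.finrank_baseChange, finrank_zzeta, Nat.totient_prime hp, Fintype.card_subtype_compl, ZMod.card]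
    simp
  have : Nonempty {a : ZMod p // a ≠ 0} := ⟨⟨1, one_ne_zero⟩⟩
  refine ⟨basisOfLinearIndependentOfCardEqFinrank hli hcard, fun a ↦ ?_⟩
  rw [coe_basisOfLinearIndependentOfCardEqFinrank]
  exact (hv a).apply_eq_smul

theorem card_powersetCard_prod_stdAddChar_eq_one {p : ℕ} [Fact p.Prime] (j : ℕ) :
    Fintype.card {s : Set.powersetCard {a : ZMod p // a ≠ 0} j //
        ∏ a ∈ (s : Finset {a : ZMod p // a ≠ 0}), (ZMod.stdAddChar a.1 : ℂ) = 1} =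
      (((Finset.univ : Finset (ZMod p)).erase 0).powersetCard j |>.filter
        fun s ↦ ∑ x ∈ s, x = 0).card := by
  have hprod (s : Finset {a : ZMod p // a ≠ 0}) :
      ∏ a ∈ s, (ZMod.stdAddChar a.1 : ℂ) = 1 ↔ ∑ a ∈ s, a.1 = 0 := by
    have hmap : ∏ a ∈ s, (ZMod.stdAddChar a.1 : ℂ) = ZMod.stdAddChar (∑ a ∈ s, a.1) := by
      induction s using Finset.cons_induction with
      | empty => simp
      | cons a s ha ih => rw [Finset.prod_cons, Finset.sum_cons, AddChar.map_add_eq_mul, ih]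
    rw [hmap, ← AddChar.map_zero_eq_one (ZMod.stdAddChar (N := p)),
      ZMod.injective_stdAddChar.eq_iff]
  rw [← Finset.card_univ]
  refine Finset.card_bij (fun s _ ↦ (s.1 : Finset {a : ZMod p // a ≠ 0}).map
    (Function.Embedding.subtype _)) ?_ ?_ ?_
  · rintro ⟨s, hs⟩ -
    rw [hprod] at hs
    simp only [Finset.mem_filter, Finset.mem_powersetCard, Finset.card_map, Finset.sum_map]
    refine ⟨⟨fun x hx ↦ ?_, s.prop⟩, hs⟩
    obtain ⟨y, -, rfl⟩ := Finset.mem_map.mp hx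
    simpa using y.2
  · rintro ⟨s, hs⟩ - ⟨t, ht⟩ - hst
    exact Subtype.ext (Subtype.ext (Finset.map_injective _ hst))
  · intro t ht
    obtain ⟨ht, ht₀⟩ := Finset.mem_filter.mp ht
    obtain ⟨hsub, hcard⟩ := Finset.mem_powersetCard.mp ht
    have hmap : (t.subtype fun a ↦ a ≠ 0).map (Function.Embedding.subtype _) = t := by
      rw [Finset.subtype_map, Finset.filter_true_of_mem]
      exact fun x hx ↦ Finset.ne_of_mem_erase (hsub hx)
    refine ⟨⟨⟨t.subtype fun a ↦ a ≠ 0, ?_⟩, ?_⟩, Finset.mem_univ _, hmap⟩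
    · rw [← hmap, Finset.card_map] at hcard
      exact hcard
    · rw [hprod]
      rw [← hmap, Finset.sum_map] at ht₀
      exact ht₀

theorem exteriorInvariants_eq_map_ker (p j : ℕ) :
    exteriorInvariants p j =
      (LinearMap.ker (exteriorPower.map j (LinearMap.mulLeft ℤ (zetaZ p)) - LinearMap.id)).map
        (⋀[ℤ]^j (Zzeta p)).subtype := by
  have hcoe : (⋀[ℤ]^j (Zzeta p)).subtype ∘ₗ
        exteriorPower.map j (LinearMap.mulLeft ℤ (zetaZ p)) =
      (ExteriorAlgebra.map (LinearMap.mulLeft ℤ (zetaZ p))).toLinearMap ∘ₗ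
        (⋀[ℤ]^j (Zzeta p)).subtype := by
    ext m
    simp
  have hiff (x : ⋀[ℤ]^j (Zzeta p)) :
      x ∈ LinearMap.ker
          (exteriorPower.map j (LinearMap.mulLeft ℤ (zetaZ p)) - LinearMap.id) ↔
        ExteriorAlgebra.map (LinearMap.mulLeft ℤ (zetaZ p)) x = x := by
    rw [LinearMap.mem_ker, LinearMap.sub_apply, LinearMap.id_apply, sub_eq_zero, Subtype.ext_iff]
    exact Eq.congr_left (LinearMap.congr_fun hcoe x)
  ext x
  rw [exteriorInvariants, Submodule.mem_inf, LinearMap.mem_eqLocus, Submodule.mem_map]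
  constructor
  · rintro ⟨hx, hfix⟩
    exact ⟨⟨x, hx⟩, (hiff ⟨x, hx⟩).mpr hfix, rfl⟩
  · rintro ⟨y, hy, rfl⟩
    exact ⟨y.2, (hiff y).mp hy⟩

/-- The invariants in `Λ^j_ℤ(ℤ[ζ])`, as a kernel inside the exterior power itself. -/
noncomputable def exteriorInvariantsEquiv (p j : ℕ) :
    exteriorInvariants p j ≃ₗ[ℤ]
      LinearMap.ker (exteriorPower.map j (LinearMap.mulLeft ℤ (zetaZ p)) - LinearMap.id) :=
  (LinearEquiv.ofEq _ _ (exteriorInvariants_eq_map_ker p j)).trans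
    (Submodule.equivMapOfInjective _ (Submodule.subtype_injective _) _).symm

theorem finrank_exteriorInvariants {p : ℕ} [Fact p.Prime] (j : ℕ) :
    finrank ℤ (exteriorInvariants p j) =
      (((Finset.univ : Finset (ZMod p)).erase 0).powersetCard j |>.filter
        fun s ↦ ∑ x ∈ s, x = 0).card := by
  classical
  let : LinearOrder {a : ZMod p // a ≠ 0} :=
    LinearOrder.lift' (fun a ↦ a.1.val) ((ZMod.val_injective p).comp Subtype.val_injective)
  obtain ⟨v, hv⟩ := exists_eigenbasis_mulLeft_zetaZ (p := p)
  rw [(exteriorInvariantsEquiv p j).finrank_eq, exteriorPower.finrank_ker_map_sub_id ℂ,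
    exteriorPower.finrank_ker_map_sub_id_of_eigenbasis j v hv,
    ← card_powersetCard_prod_stdAddChar_eq_one]

/-- For `0 ≤ j ≤ p-1` the group of `ℤ/p`-invariants of `Λ^j_ℤ(ℤ[ζ])` (with `ℤ/p` acting by
multiplication by `ζ`) is a free abelian group of rank `(1/p)(C(p-1, j) + (-1)^j (p-1))`;
moreover `Λ^j_ℤ(ℤ[ζ]) = 0` for `j ≥ p`. -/
theorem exterior_power_invariants_rank (p : ℕ) (hp : p.Prime) (hodd : Odd p) :
    (∀ j : ℕ, j ≤ p - 1 →
      ∃ r : ℕ, (p : ℤ) * r = ((p - 1).choose j : ℤ) + (-1) ^ j * ((p : ℤ) - 1) ∧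
        Nonempty (exteriorInvariants p j ≃+ (Fin r → ℤ))) ∧
      ∀ j : ℕ, p ≤ j → ⋀[ℤ]^j (Zzeta p) = ⊥ := by
  have := Fact.mk hp
  have hpos := hp.pos
  refine ⟨fun j hj ↦ ⟨finrank ℤ (exteriorInvariants p j), ?_, ?_⟩, fun j hj ↦ ?_⟩
  · rw [finrank_exteriorInvariants, mul_card_powersetCard_erase_filter_sum_eq_zero (by omega)]
  · have := LinearMap.free_ker
      (exteriorPower.map j (LinearMap.mulLeft ℤ (zetaZ p)) - LinearMap.id)
    have : Module.Free ℤ (exteriorInvariants p j) := Module.Free.of_equiv (exteriorInvariantsEquiv p j).symm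
    have : Module.Finite ℤ (exteriorInvariants p j) := Module.Finite.equiv (exteriorInvariantsEquiv p j).symm
    exact ⟨(Module.finBasis ℤ (exteriorInvariants p j)).equivFun.toAddEquiv⟩
  · have h := exteriorPower.finrank_eq (R := ℤ) (n := j) (M := Zzeta p)
    rw [finrank_zzeta, Nat.totient_prime hp, Nat.choose_eq_zero_of_lt (by omega), Module.finrank_zero_iff] at h
    exact Submodule.subsingleton_iff_eq_bot.mp h
end
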